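/- Let K ≥ 2 be a natural number and let Ω = ZMod K * ZMod K be the free product of two copies of the cyclic group of order K, with x the generator of the first free factor and y the generator of the second. For 1 ≤ i, j ≤ K−1 set g_{ij} = x^i · (y^j x y^{−j} x^{−1}) · x^{−i}. Then the family (g_{ij}) is a free family: the group homomorphism from the free group on (K−1)² generators to Ω sending the (i,j)-th generator to g_{ij} is injective. In particular the subgroup of Ω generated by the g_{ij} is free of rank (K−1)². -/

import Mathlib

/-- The generator of the first free factor of `ℤ_K * ℤ_K`. -/
def xgen (K : ℕ) : Monoid.CoprodI (fun _ : Fin 2 => Multiplicative (ZMod K)) :=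
  Monoid.CoprodI.of (i := (0 : Fin 2)) (Multiplicative.ofAdd (1 : ZMod K))

/-- The generator of the second free factor of `ℤ_K * ℤ_K`. -/
def ygen (K : ℕ) : Monoid.CoprodI (fun _ : Fin 2 => Multiplicative (ZMod K)) :=
  Monoid.CoprodI.of (i := (1 : Fin 2)) (Multiplicative.ofAdd (1 : ZMod K))

/-- The free generator with (shifted) indices `(n, m - 1)`, extended by `1` to all naturals. -/
def extGen (K n m : ℕ) : FreeGroup (Fin (K - 1) × Fin (K - 1)) :=
  if h : n < K - 1 ∧ 1 ≤ m ∧ m - 1 < K - 1 then FreeGroup.of (⟨n, h.1⟩, ⟨m - 1, h.2.2⟩) else 1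

/-- The product of the first `n` extended generators in column `m`. -/
def partialProd (K n m : ℕ) : FreeGroup (Fin (K - 1) × Fin (K - 1)) :=
  ((List.range n).map fun k => extGen K k m).prod

/-- The partial products as a function on the torus `(ℤ/K)²`, starting from the column `1`. -/
def torusGauge (K : ℕ) (a b : ZMod K) : FreeGroup (Fin (K - 1) × Fin (K - 1)) :=
  partialProd K (a - 1).val b.val

theorem partialProd_succ (K n m : ℕ) :
    partialProd K (n + 1) m = partialProd K n m * extGen K n m := by
  simp [partialProd, List.range_succ]

theorem partialProd_zero_right (K n : ℕ) : partialProd K n 0 = 1 := by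
  induction n with
  | zero => simp [partialProd]
  | succ n ih => simp [partialProd_succ, ih, extGen]

theorem torusGauge_zero_right (K : ℕ) (a : ZMod K) : torusGauge K a 0 = 1 := by
  simp [torusGauge, partialProd_zero_right]

theorem torusGauge_succ {K : ℕ} (i j : Fin (K - 1)) :
    torusGauge K (((i : ℕ) + 1 : ℕ) + 1) ((j : ℕ) + 1 : ℕ) =
      torusGauge K ((i : ℕ) + 1 : ℕ) ((j : ℕ) + 1 : ℕ) * FreeGroup.of (i, j) := by
  have hi := i.isLt
  have hj := j.isLt
  have hleft : ((((i : ℕ) + 1 : ℕ) + 1 - 1 : ZMod K)).val = (i : ℕ) + 1 := by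
    rw [add_sub_cancel_right, ZMod.val_natCast_of_lt (by omega)]
  have hright : ((((i : ℕ) + 1 : ℕ) - 1 : ZMod K)).val = (i : ℕ) := by
    rw [Nat.cast_succ, add_sub_cancel_right, ZMod.val_natCast_of_lt (by omega)]
  have hcol : (((j : ℕ) + 1 : ℕ) : ZMod K).val = (j : ℕ) + 1 :=
    ZMod.val_natCast_of_lt (by omega)
  rw [torusGauge, torusGauge, hleft, hright, hcol, partialProd_succ]
  simp [extGen]

/-- The covering of the torus `(ℤ/K)²` with fibre the free group on `(K-1)²` generators. -/
abbrev TorusCover (K : ℕ) : Type :=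
  FreeGroup (Fin (K - 1) × Fin (K - 1)) × ZMod K × ZMod K

/-- Translation of the first coordinate, twisted by `torusGauge`. -/
def horizontalStep {K : ℕ} (m : ZMod K) (s : TorusCover K) : TorusCover K :=
  ((torusGauge K (s.2.1 - m) s.2.2)⁻¹ * torusGauge K s.2.1 s.2.2 * s.1, s.2.1 - m, s.2.2)

/-- Translation of the second coordinate. -/
def verticalStep {K : ℕ} (m : ZMod K) (s : TorusCover K) : TorusCover K :=
  (s.1, s.2.1, s.2.2 - m)

theorem horizontalStep_zero {K : ℕ} (s : TorusCover K) : horizontalStep 0 s = s := by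
  simp [horizontalStep]

theorem horizontalStep_add {K : ℕ} (m n : ZMod K) (s : TorusCover K) :
    horizontalStep (m + n) s = horizontalStep m (horizontalStep n s) := by
  simp [horizontalStep, mul_assoc, sub_sub, add_comm]

theorem verticalStep_zero {K : ℕ} (s : TorusCover K) : verticalStep 0 s = s := by
  simp [verticalStep]

theorem verticalStep_add {K : ℕ} (m n : ZMod K) (s : TorusCover K) :
    verticalStep (m + n) s = verticalStep m (verticalStep n s) := by
  simp [verticalStep, sub_sub, add_comm]

/-- The action of the first factor, by `horizontalStep`. -/
def horizontalShift (K : ℕ) : Multiplicative (ZMod K) →* Equiv.Perm (TorusCover K) :=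
  MonoidHom.toHomPerm
    { toFun := fun m => horizontalStep m.toAdd
      map_one' := funext horizontalStep_zero
      map_mul' := fun m n => funext (horizontalStep_add m.toAdd n.toAdd) }

theorem horizontalShift_apply (K : ℕ) (m : Multiplicative (ZMod K)) (s : TorusCover K) :
    horizontalShift K m s = horizontalStep m.toAdd s :=
  rfl

/-- The action of the second factor, by `verticalStep`. -/
def verticalShift (K : ℕ) : Multiplicative (ZMod K) →* Equiv.Perm (TorusCover K) :=
  MonoidHom.toHomPerm
    { toFun := fun m => verticalStep m.toAdd
      map_one' := funext verticalStep_zero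
      map_mul' := fun m n => funext (verticalStep_add m.toAdd n.toAdd) }

theorem verticalShift_apply (K : ℕ) (m : Multiplicative (ZMod K)) (s : TorusCover K) :
    verticalShift K m s = verticalStep m.toAdd s :=
  rfl

/-- The action of `ℤ_K * ℤ_K` on the covering of the torus. -/
def coverAction (K : ℕ) :
    Monoid.CoprodI (fun _ : Fin 2 => Multiplicative (ZMod K)) →* Equiv.Perm (TorusCover K) :=
  Monoid.CoprodI.lift fun i => if i = 0 then horizontalShift K else verticalShift K

theorem coverAction_of_zero (K : ℕ) (m : Multiplicative (ZMod K)) :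
    coverAction K (Monoid.CoprodI.of (i := (0 : Fin 2)) m) = horizontalShift K m := by
  simp [coverAction]

theorem coverAction_of_one (K : ℕ) (m : Multiplicative (ZMod K)) :
    coverAction K (Monoid.CoprodI.of (i := (1 : Fin 2)) m) = verticalShift K m := by
  simp [coverAction]

theorem xgen_pow (K n : ℕ) :
    xgen K ^ n = Monoid.CoprodI.of (i := (0 : Fin 2)) (Multiplicative.ofAdd (n : ZMod K)) := by
  rw [xgen, ← map_pow, ← ofAdd_nsmul, nsmul_one]

theorem ygen_pow (K n : ℕ) :
    ygen K ^ n = Monoid.CoprodI.of (i := (1 : Fin 2)) (Multiplicative.ofAdd (n : ZMod K)) := by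
  rw [ygen, ← map_pow, ← ofAdd_nsmul, nsmul_one]

theorem coverAction_commutator_conj {K : ℕ} (i j : Fin (K - 1))
    (f : FreeGroup (Fin (K - 1) × Fin (K - 1))) :
    coverAction K (xgen K ^ ((i : ℕ) + 1) *
        (ygen K ^ ((j : ℕ) + 1) * xgen K * (ygen K ^ ((j : ℕ) + 1))⁻¹ * (xgen K)⁻¹) *
        (xgen K ^ ((i : ℕ) + 1))⁻¹) (f, 0, 0) = (FreeGroup.of (i, j) * f, 0, 0) := by
  rw [xgen_pow, ygen_pow, xgen]
  simp only [← map_inv, map_mul, coverAction_of_zero, coverAction_of_one]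
  simp only [Equiv.Perm.mul_apply, horizontalShift_apply, verticalShift_apply,
    horizontalStep, verticalStep, toAdd_inv, toAdd_ofAdd, sub_neg_eq_add, zero_add,
    torusGauge_zero_right, inv_one, one_mul, sub_self, add_sub_cancel_right]
  rw [torusGauge_succ, inv_mul_cancel_left]

/-- A homomorphism from a free group is injective as soon as its composite with some action
realizes left translation on a copy of the free group. -/
theorem freeGroup_lift_injective_of_left_translation {α G S : Type*} [Group G] (g : α → G)
    (φ : G →* Equiv.Perm S) (ι : FreeGroup α → S) (hι : Function.Injective ι)
    (h : ∀ a f, φ (g a) (ι f) = ι (FreeGroup.of a * f)) :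
    Function.Injective (FreeGroup.lift g) := by
  have key : ∀ w f, φ (FreeGroup.lift g w) (ι f) = ι (w * f) := by
    intro w
    induction w using FreeGroup.induction_on with
    | C1 => intro f; simp
    | of a => intro f; simpa using h a f
    | inv_of a _ =>
      intro f
      rw [map_inv, map_inv, Equiv.Perm.inv_eq_iff_eq, FreeGroup.lift_apply_of, h,
        mul_inv_cancel_left]
    | mul u v hu hv =>
      intro f
      rw [map_mul, map_mul, Equiv.Perm.mul_apply, hv, hu, mul_assoc]
  intro u v huv
  simpa [huv, key v 1, hι.eq_iff, eq_comm] using key u 1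

/-- In `Ω = ℤ_K * ℤ_K`, the elements `g_{ij} = x^i [y^j, x] x^{-i}` for `1 ≤ i,j ≤ K-1`
form a free family: the homomorphism from the free group on `(K-1)²` generators sending
the `(i,j)`-th generator to `g_{ij}` is injective.  In particular, the subgroup they
generate is free of rank `(K-1)²`. -/
theorem stmt5 (K : ℕ) (hK : 2 ≤ K) :
    Function.Injective
      (FreeGroup.lift fun q : Fin (K - 1) × Fin (K - 1) =>
        xgen K ^ ((q.1 : ℕ) + 1) *
          (ygen K ^ ((q.2 : ℕ) + 1) * xgen K * (ygen K ^ ((q.2 : ℕ) + 1))⁻¹ *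
            (xgen K)⁻¹) *
          (xgen K ^ ((q.1 : ℕ) + 1))⁻¹) ∧
    Nonempty
      (↥(Subgroup.closure (Set.range fun q : Fin (K - 1) × Fin (K - 1) =>
          xgen K ^ ((q.1 : ℕ) + 1) *
            (ygen K ^ ((q.2 : ℕ) + 1) * xgen K * (ygen K ^ ((q.2 : ℕ) + 1))⁻¹ *
              (xgen K)⁻¹) *
            (xgen K ^ ((q.1 : ℕ) + 1))⁻¹))
        ≃* FreeGroup (Fin (K - 1) × Fin (K - 1))) := by
  have hinj := freeGroup_lift_injective_of_left_translation
    (fun q : Fin (K - 1) × Fin (K - 1) =>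
      xgen K ^ ((q.1 : ℕ) + 1) *
        (ygen K ^ ((q.2 : ℕ) + 1) * xgen K * (ygen K ^ ((q.2 : ℕ) + 1))⁻¹ * (xgen K)⁻¹) *
        (xgen K ^ ((q.1 : ℕ) + 1))⁻¹)
    (coverAction K) (fun f => (f, 0, 0)) (fun _ _ h => congrArg Prod.fst h)
    (fun q f => coverAction_commutator_conj q.1 q.2 f)
  refine ⟨hinj, ⟨?_⟩⟩
  rw [← FreeGroup.range_lift_eq_closure]
  exact (MonoidHom.ofInjective hinj).symm
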